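/- arXiv:2205.13432 — 3 statements merged into one kernel-verified Lean document; each statement's English description precedes it below -/
import Mathlib

section
/- Let c ∈ de(b) with c ≠ b and let W = an(c). If b is not fixable in G_W (i.e., there exists c' ≠ b with c' ∈ de_W(b) ∩ dis_W(b)), then there exists c' ∈ de(b) with c' ≠ b such that for every S ⊆ V \ {b, c'} there exist a D-supported Λ and a B-compatible Ω whose associated Σ and P satisfy P b c' ≠ β_{bc'·S}; that is, the directed-path sum P b c' is not regression identifiable. -/
open Matrix

attribute [local instance] Classical.propDecidable

namespace EdgeIntervention

variable {n : ℕ}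

/-- Descendants of `b` (including `b`): vertices reachable under the edge relation of `D`. -/
def desc (D : Set (Fin n × Fin n)) (b : Fin n) : Set (Fin n) :=
  {c | Relation.ReflTransGen (fun i j => (i, j) ∈ D) b c}

/-- Ancestors of `c` (including `c`). -/
def anc (D : Set (Fin n × Fin n)) (c : Fin n) : Set (Fin n) :=
  {i | c ∈ desc D i}

/-- Descendants of `b` in the induced subgraph on `W`. -/
def descW (D : Set (Fin n × Fin n)) (W : Set (Fin n)) (b : Fin n) : Set (Fin n) :=
  {c | Relation.ReflTransGen (fun i j => (i, j) ∈ D ∧ i ∈ W ∧ j ∈ W) b c}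

/-- District of `b` in the induced subgraph on `W`. -/
def disW (B : Set (Fin n × Fin n)) (W : Set (Fin n)) (b : Fin n) : Set (Fin n) :=
  {c | Relation.ReflTransGen (fun i j => (i, j) ∈ B ∧ i ∈ W ∧ j ∈ W) b c}

/-- Markov blanket of `b` in the induced subgraph on `W`. -/
def mbW (D B : Set (Fin n × Fin n)) (W : Set (Fin n)) (b : Fin n) : Set (Fin n) :=
  (disW B W b ∪ {i | i ∈ W ∧ ∃ d ∈ disW B W b, (i, d) ∈ D}) \ {b}

/-- `Λ` is supported on the directed edge set `D`. -/
def DSupported (D : Set (Fin n × Fin n)) (Λ : Matrix (Fin n) (Fin n) ℝ) : Prop :=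
  ∀ i j, (i, j) ∉ D → Λ i j = 0

/-- `Ω` is compatible with the bidirected edge set `B`: symmetric, positive definite,
and vanishing off the diagonal and off `B`. -/
def BCompatible (B : Set (Fin n × Fin n)) (Ω : Matrix (Fin n) (Fin n) ℝ) : Prop :=
  Ω.IsSymm ∧ Ω.PosDef ∧ ∀ i j, i ≠ j → (i, j) ∉ B → Ω i j = 0

/-- The covariance matrix `Σ = ((1 - Λ)⁻¹)ᵀ * Ω * (1 - Λ)⁻¹` of the linear SEM. -/
noncomputable def cov (Λ Ω : Matrix (Fin n) (Fin n) ℝ) : Matrix (Fin n) (Fin n) ℝ :=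
  ((1 - Λ)⁻¹)ᵀ * Ω * (1 - Λ)⁻¹

/-- Sum over all directed paths from `i` to `j` of their weights.  A path with `k` edges is
encoded as `f : Fin (k+1) → Fin n` with all steps in `D`; since edges strictly increase,
every directed path has at most `n` edges, so `k` ranges over `Finset.range (n+1)`. -/
noncomputable def pathSum (D : Set (Fin n × Fin n)) (Λ : Matrix (Fin n) (Fin n) ℝ)
    (i j : Fin n) : ℝ :=
  ∑ k ∈ Finset.range (n + 1),
    ∑ f ∈ Finset.univ.filter
        (fun f : Fin (k + 1) → Fin n =>
          f 0 = i ∧ f (Fin.last k) = j ∧ ∀ t : Fin k, (f t.castSucc, f t.succ) ∈ D),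
      ∏ t : Fin k, Λ (f t.castSucc) (f t.succ)

/-- Conditional covariance `σ_{vw·S} = Σ v w − Σ_{vS} (Σ_{SS})⁻¹ Σ_{Sw}`. -/
noncomputable def condCov (Cov : Matrix (Fin n) (Fin n) ℝ) (S : Set (Fin n))
    (v w : Fin n) : ℝ :=
  letI := (Set.toFinite S).fintype
  Cov v w - ∑ i : S, ∑ j : S,
    Cov v i.val * (Cov.submatrix (Subtype.val : S → Fin n) Subtype.val)⁻¹ i j * Cov j.val w

/-- Regression coefficient `β_{vw·S} = σ_{vw·S} / σ_{vv·S}`. -/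
noncomputable def regCoef (Cov : Matrix (Fin n) (Fin n) ℝ) (S : Set (Fin n))
    (v w : Fin n) : ℝ :=
  condCov Cov S v w / condCov Cov S v v

/-- The matrix obtained from `Λ` by setting the `(a,b)` entry to `0`
(removal of the directed edge `a → b`). -/
def removeEdge (Λ : Matrix (Fin n) (Fin n) ℝ) (a b : Fin n) : Matrix (Fin n) (Fin n) ℝ :=
  Matrix.of fun i j => if i = a ∧ j = b then 0 else Λ i j

/-- The matrix obtained from `Ω` by setting the `(a,b)` and `(b,a)` entries to `0`
(removal of the bidirected edge `a ↔ b`). -/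
def removeBi (Ω : Matrix (Fin n) (Fin n) ℝ) (a b : Fin n) : Matrix (Fin n) (Fin n) ℝ :=
  Matrix.of fun i j => if (i = a ∧ j = b) ∨ (i = b ∧ j = a) then 0 else Ω i j

section LinearAlgebra

lemma exists_residual {C : Matrix (Fin n) (Fin n) ℝ} (hC : C.PosDef) {S : Set (Fin n)}
    {w : Fin n} (hw : w ∉ S) :
    ∃ x : Fin n → ℝ, x w = 1 ∧ (∀ v, v ∉ S → v ≠ w → x v = 0) ∧
      (∀ s ∈ S, (C *ᵥ x) s = 0) ∧ ∀ v, condCov C S v w = (C *ᵥ x) v := by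
  let _ := (Set.toFinite S).fintype
  set M := C.submatrix (Subtype.val : S → Fin n) Subtype.val with hM
  have hunit : IsUnit M.det :=
    (Matrix.isUnit_iff_isUnit_det _).1 (hC.submatrix Subtype.val_injective).isUnit
  set y : S → ℝ := M⁻¹ *ᵥ (fun j => C j.val w) with hy
  have hMy : M *ᵥ y = fun j => C j.val w := by
    rw [hy, Matrix.mulVec_mulVec, Matrix.mul_nonsing_inv _ hunit, Matrix.one_mulVec]
  have hCx : ∀ v, (C *ᵥ (Pi.single w 1 - ∑ i : S, Pi.single i.val (y i))) v
      = C v w - ∑ i : S, C v i.val * y i := by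
    intro v
    simp [Matrix.mulVec_sub, Matrix.mulVec_sum, mul_comm]
  refine ⟨Pi.single w 1 - ∑ i : S, Pi.single i.val (y i), ?_, ?_, ?_, ?_⟩
  · have : ∀ i : S, (Pi.single i.val (y i) : Fin n → ℝ) w = 0 := fun i =>
      Pi.single_eq_of_ne (fun h => hw (by rw [h]; exact i.2)) _
    simp [Finset.sum_apply, this]
  · intro v hv hvw
    have : ∀ i : S, (Pi.single i.val (y i) : Fin n → ℝ) v = 0 := fun i =>
      Pi.single_eq_of_ne (fun h => hv (by rw [h]; exact i.2)) _
    simp [Finset.sum_apply, this, hvw]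
  · intro s hs
    have h := congrFun hMy ⟨s, hs⟩
    simp only [Matrix.mulVec, dotProduct, hM, Matrix.submatrix_apply] at h
    rw [hCx, h, sub_self]
  · intro v
    rw [hCx]
    simp only [condCov, hy, Matrix.mulVec, dotProduct, Finset.mul_sum, mul_assoc]
    rfl

lemma dotProduct_mulVec_residual {C : Matrix (Fin n) (Fin n) ℝ} {S : Set (Fin n)} {w : Fin n}
    {x : Fin n → ℝ} (h0 : ∀ v, v ∉ S → v ≠ w → x v = 0) (hS : ∀ s ∈ S, (C *ᵥ x) s = 0) :
    x ⬝ᵥ (C *ᵥ x) = x w * (C *ᵥ x) w := by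
  refine Finset.sum_eq_single w (fun v _ hv => ?_) (by simp)
  by_cases h : v ∈ S
  · rw [hS v h, mul_zero]
  · rw [h0 v h hv, zero_mul]

lemma condCov_self_pos {C : Matrix (Fin n) (Fin n) ℝ} (hC : C.PosDef) {S : Set (Fin n)}
    {w : Fin n} (hw : w ∉ S) : 0 < condCov C S w w := by
  obtain ⟨x, h1, h0, hS, hx⟩ := exists_residual hC hw
  have hne : x ≠ 0 := fun h => by simp [h] at h1
  have := hC.dotProduct_mulVec_pos hne
  rwa [star_trivial, dotProduct_mulVec_residual h0 hS, h1, one_mul, ← hx] at this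

lemma condCov_eq_of_residual {C : Matrix (Fin n) (Fin n) ℝ} (hC : C.PosDef) {S : Set (Fin n)}
    {w : Fin n} (hw : w ∉ S) {x : Fin n → ℝ} (h1 : x w = 1)
    (h0 : ∀ v, v ∉ S → v ≠ w → x v = 0) (hS : ∀ s ∈ S, (C *ᵥ x) s = 0) (v : Fin n) :
    condCov C S v w = (C *ᵥ x) v := by
  obtain ⟨x', h1', h0', hS', hx'⟩ := exists_residual hC hw
  rw [hx']
  suffices x' - x = 0 by rw [sub_eq_zero.1 this]
  by_contra hne
  have hpos := hC.dotProduct_mulVec_pos hne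
  rw [star_trivial, dotProduct_mulVec_residual (S := S) (w := w)] at hpos
  · simp [h1, h1'] at hpos
  · intro v hv hvw
    simp [h0 v hv hvw, h0' v hv hvw]
  · intro s hs
    simp [Matrix.mulVec_sub, hS s hs, hS' s hs]

lemma isUnit_det_one_sub {Λ : Matrix (Fin n) (Fin n) ℝ} (hΛ : ∀ i j, Λ i j ≠ 0 → i < j) :
    IsUnit (1 - Λ).det := by
  have hdiag : ∀ i, Λ i i = 0 := fun i => by_contra fun h => lt_irrefl _ (hΛ i i h)
  have htri : (1 - Λ).IsUpperTriangular := by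
    intro i j hji
    have h : Λ i j = 0 := by_contra fun h => lt_asymm hji (hΛ i j h)
    rw [Matrix.sub_apply, h, sub_zero]
    exact Matrix.one_apply_ne (ne_of_gt hji)
  rw [Matrix.det_of_isUpperTriangular htri]
  simp [hdiag]

lemma inv_mulVec_eq {M : Matrix (Fin n) (Fin n) ℝ} (hM : IsUnit M.det) {x y : Fin n → ℝ}
    (h : M *ᵥ x = y) : M⁻¹ *ᵥ y = x := by
  rw [← h, Matrix.mulVec_mulVec, Matrix.nonsing_inv_mul _ hM, Matrix.one_mulVec]

lemma posDef_cov {Λ Ω : Matrix (Fin n) (Fin n) ℝ} (hΛ : IsUnit (1 - Λ).det) (hΩ : Ω.PosDef) :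
    (cov Λ Ω).PosDef := by
  have := hΩ.conjTranspose_mul_mul_same (B := (1 - Λ)⁻¹)
    (Matrix.mulVec_injective_of_isUnit
      ((Matrix.isUnit_iff_isUnit_det _).2 (Matrix.isUnit_nonsing_inv_det _ hΛ)))
  rwa [Matrix.conjTranspose_eq_transpose_of_trivial] at this

lemma cov_mulVec (Λ Ω : Matrix (Fin n) (Fin n) ℝ) (x : Fin n → ℝ) :
    cov Λ Ω *ᵥ x = ((1 - Λ)⁻¹)ᵀ *ᵥ (Ω *ᵥ ((1 - Λ)⁻¹ *ᵥ x)) := by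
  simp [cov, Matrix.mulVec_mulVec, Matrix.mul_assoc]

end LinearAlgebra

section NegativelyCorrelatedNoise

/-- The noise covariance with unit variances and the same small negative covariance along
every bidirected edge. -/
noncomputable def negNoise (B : Set (Fin n × Fin n)) : Matrix (Fin n) (Fin n) ℝ :=
  1 - Matrix.of fun i j => if (i, j) ∈ B then ((n : ℝ) + 1)⁻¹ else 0

lemma negNoise_mulVec (B : Set (Fin n × Fin n)) (z : Fin n → ℝ) (u : Fin n) :
    (negNoise B *ᵥ z) u = z u - ∑ v, (if (u, v) ∈ B then ((n : ℝ) + 1)⁻¹ else 0) * z v := by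
  rw [negNoise, Matrix.sub_mulVec, Matrix.one_mulVec]
  rfl

lemma sum_inv_succ_lt_one : ∑ _v : Fin n, ((n : ℝ) + 1)⁻¹ < 1 := by
  have : (0 : ℝ) < n + 1 := by positivity
  rw [Finset.sum_const, Finset.card_univ, Fintype.card_fin, nsmul_eq_mul, ← div_eq_mul_inv,
    div_lt_one this]
  linarith

lemma bCompatible_negNoise {B : Set (Fin n × Fin n)} (hBsymm : ∀ i j, (i, j) ∈ B → (j, i) ∈ B) :
    BCompatible B (negNoise B) := by
  have hsymm : (negNoise B).IsSymm := by
    ext i j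
    have hij : (j, i) ∈ B ↔ (i, j) ∈ B := ⟨hBsymm _ _, hBsymm _ _⟩
    simp [negNoise, hij, Matrix.one_apply, eq_comm]
  refine ⟨hsymm, ?_, ?_⟩
  · refine Matrix.PosDef.of_dotProduct_mulVec_pos ?_ ?_
    · rwa [Matrix.IsHermitian, Matrix.conjTranspose_eq_transpose_of_trivial]
    · intro x hx
      set e : ℝ := ((n : ℝ) + 1)⁻¹ with he
      have he0 : 0 < e := by positivity
      have hsq : 0 < ∑ u, x u ^ 2 := by
        obtain ⟨u, hu⟩ := Function.ne_iff.1 hx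
        exact Finset.sum_pos' (fun _ _ => sq_nonneg _) ⟨u, Finset.mem_univ _, by
          have : x u ≠ 0 := hu
          positivity⟩
      have hbound : ∑ u, ∑ v, x u * ((if (u, v) ∈ B then e else 0) * x v)
          ≤ ∑ u : Fin n, ∑ v : Fin n, e * ((x u ^ 2 + x v ^ 2) / 2) := by
        refine Finset.sum_le_sum fun u _ => Finset.sum_le_sum fun v _ => ?_
        split_ifs
        · nlinarith [sq_nonneg (x u - x v)]
        · rw [zero_mul, mul_zero]
          positivity
      have hn : ∑ u : Fin n, ∑ v : Fin n, e * ((x u ^ 2 + x v ^ 2) / 2)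
          = (∑ _v : Fin n, e) * ∑ u, x u ^ 2 := by
        simp only [← Finset.mul_sum, ← Finset.sum_div, Finset.sum_add_distrib, Finset.sum_const,
          Finset.card_univ, Fintype.card_fin, nsmul_eq_mul]
        ring
      have hlt : (∑ _v : Fin n, e) * ∑ u, x u ^ 2 < 1 * ∑ u, x u ^ 2 :=
        mul_lt_mul_of_pos_right sum_inv_succ_lt_one hsq
      have hval : star x ⬝ᵥ (negNoise B *ᵥ x)
          = ∑ u, x u ^ 2 - ∑ u, ∑ v, x u * ((if (u, v) ∈ B then e else 0) * x v) := by
        simp only [star_trivial, dotProduct, negNoise_mulVec, mul_sub, Finset.sum_sub_distrib,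
          Finset.mul_sum, sq, he]
      rw [hval]
      linarith
  · intro i j hij hB
    simp [negNoise, hij, hB]

lemma negNoise_mulVec_neg_of_min {B : Set (Fin n × Fin n)} {z : Fin n → ℝ} {u : Fin n}
    (hmin : ∀ v, z u ≤ z v) (hu : z u < 0) : (negNoise B *ᵥ z) u < 0 := by
  rw [negNoise_mulVec]
  have he0 : (0 : ℝ) < ((n : ℝ) + 1)⁻¹ := by positivity
  have h : (∑ _v : Fin n, ((n : ℝ) + 1)⁻¹) * z u
      ≤ ∑ v, (if (u, v) ∈ B then ((n : ℝ) + 1)⁻¹ else 0) * z v := by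
    rw [Finset.sum_mul]
    refine Finset.sum_le_sum fun v _ => ?_
    split_ifs
    · exact mul_le_mul_of_nonneg_left (hmin v) he0.le
    · rw [zero_mul]
      exact (mul_neg_of_pos_of_neg he0 hu).le
  nlinarith [sum_inv_succ_lt_one (n := n)]

lemma negNoise_mulVec_nonpos {B : Set (Fin n × Fin n)} {z : Fin n → ℝ} (hz : ∀ v, 0 ≤ z v)
    {u : Fin n} (hu : z u = 0) : (negNoise B *ᵥ z) u ≤ 0 := by
  rw [negNoise_mulVec, hu, zero_sub, neg_nonpos]
  refine Finset.sum_nonneg fun v _ => mul_nonneg ?_ (hz v)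
  split_ifs <;> positivity

lemma negNoise_mulVec_neg_of_adj {B : Set (Fin n × Fin n)} {z : Fin n → ℝ} (hz : ∀ v, 0 ≤ z v)
    {u v : Fin n} (hu : z u = 0) (huv : (u, v) ∈ B) (hv : 0 < z v) :
    (negNoise B *ᵥ z) u < 0 := by
  rw [negNoise_mulVec, hu, zero_sub, neg_lt_zero]
  refine Finset.sum_pos' (fun v _ => mul_nonneg ?_ (hz v)) ⟨v, Finset.mem_univ _, ?_⟩
  · split_ifs <;> positivity
  · rw [if_pos huv]
    positivity

end NegativelyCorrelatedNoise

section Forest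

variable (T : Set (Fin n)) (nxt : Fin n → Fin n)

/-- The vertex of `T` in which the walk from `v` along `nxt` first enters `T`. -/
noncomputable def root (hlt : ∀ v ∉ T, v < nxt v) (v : Fin n) : Fin n :=
  if h : v ∈ T then v else
    have := hlt v h
    root hlt (nxt v)
termination_by n - v.val

/-- Unit weights on the edges `v → nxt v` for `v` outside `T`. -/
noncomputable def forest : Matrix (Fin n) (Fin n) ℝ :=
  Matrix.of fun v u => if v ∉ T ∧ u = nxt v then 1 else 0

variable {T nxt}

lemma root_of_mem (hlt : ∀ v ∉ T, v < nxt v) {v : Fin n} (h : v ∈ T) : root T nxt hlt v = v := by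
  rw [root, dif_pos h]

lemma root_of_notMem (hlt : ∀ v ∉ T, v < nxt v) {v : Fin n} (h : v ∉ T) :
    root T nxt hlt v = root T nxt hlt (nxt v) := by
  rw [root, dif_neg h]

lemma root_mem (hlt : ∀ v ∉ T, v < nxt v) (v : Fin n) : root T nxt hlt v ∈ T := by
  induction v using WellFoundedGT.induction with
  | ind v ih =>
    by_cases h : v ∈ T
    · rwa [root_of_mem hlt h]
    · rw [root_of_notMem hlt h]
      exact ih _ (hlt v h)

lemma root_of_closed (hlt : ∀ v ∉ T, v < nxt v) {p : Fin n → Prop}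
    (hp : ∀ v ∉ T, p v → p (nxt v)) {v : Fin n} (hv : p v) : p (root T nxt hlt v) := by
  induction v using WellFoundedGT.induction with
  | ind v ih =>
    by_cases h : v ∈ T
    · rwa [root_of_mem hlt h]
    · rw [root_of_notMem hlt h]
      exact ih _ (hlt v h) (hp v h hv)

lemma forest_mulVec (x : Fin n → ℝ) (v : Fin n) :
    (forest T nxt *ᵥ x) v = if v ∈ T then 0 else x (nxt v) := by
  by_cases h : v ∈ T <;> simp [forest, Matrix.mulVec, dotProduct, h]

lemma isUnit_det_one_sub_forest (hlt : ∀ v ∉ T, v < nxt v) :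
    IsUnit (1 - forest T nxt).det := by
  refine isUnit_det_one_sub fun i j hij => ?_
  simp only [forest, Matrix.of_apply, ne_eq, ite_eq_right_iff, one_ne_zero, imp_false,
    not_not] at hij
  rw [hij.2]
  exact hlt i hij.1

lemma inv_one_sub_forest_mulVec (hlt : ∀ v ∉ T, v < nxt v) {x : Fin n → ℝ}
    (hx : ∀ v ∉ T, x v = 0) :
    (1 - forest T nxt)⁻¹ *ᵥ x = fun v => x (root T nxt hlt v) := by
  refine inv_mulVec_eq (isUnit_det_one_sub_forest hlt) ?_
  ext v
  rw [Matrix.sub_mulVec, Matrix.one_mulVec, Pi.sub_apply, forest_mulVec]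
  by_cases h : v ∈ T
  · simp [h, root_of_mem hlt h]
  · simp [h, hx v h, root_of_notMem hlt h]

lemma inv_one_sub_forest_apply (hlt : ∀ v ∉ T, v < nxt v) {w : Fin n} (hw : w ∈ T) (v : Fin n) :
    (1 - forest T nxt)⁻¹ v w = if root T nxt hlt v = w then 1 else 0 := by
  have h := congrFun (inv_one_sub_forest_mulVec hlt (x := Pi.single w 1)
    fun v hv => Pi.single_eq_of_ne (fun h => hv (by rwa [h])) _) v
  simpa [Pi.single_apply] using h

lemma dSupported_forest {D : Set (Fin n × Fin n)} (h : ∀ v ∉ T, (v, nxt v) ∈ D) :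
    DSupported D (forest T nxt) := by
  intro i j hij
  simp only [forest, Matrix.of_apply, ite_eq_right_iff, one_ne_zero, imp_false, not_and]
  rintro hi rfl
  exact hij (h i hi)

end Forest

section Graph

variable {D B : Set (Fin n × Fin n)}

lemma le_of_mem_desc (hD : ∀ i j : Fin n, (i, j) ∈ D → i < j) {i j : Fin n} (h : j ∈ desc D i) :
    i ≤ j := by
  refine Relation.ReflTransGen.head_induction_on h le_rfl fun hab _ ih => ?_
  exact (hD _ _ hab).le.trans ih

lemma exists_child {v c : Fin n} (hv : v ∈ anc D c) (hvc : v ≠ c) :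
    ∃ u, (v, u) ∈ D ∧ u ∈ anc D c := by
  rcases Relation.ReflTransGen.cases_head hv with h | ⟨u, hu, huc⟩
  · exact absurd h hvc
  · exact ⟨u, hu, huc⟩

/-- Along a forest whose paths towards `c` run through `S`, the regression coefficient of `c` on
`b` given `S` vanishes although `b` has a total effect on `c`. -/
lemma exists_ne_regCoef_of_mem (hD : ∀ i j : Fin n, (i, j) ∈ D → i < j) {S : Set (Fin n)}
    {b c s : Fin n} (hcS : c ∉ S) (hsS : s ∈ S) (hbs : s ∈ desc D b) (hsc : s ∈ anc D c) :
    ∃ Λ Ω : Matrix (Fin n) (Fin n) ℝ, DSupported D Λ ∧ BCompatible B Ω ∧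
      (1 - Λ)⁻¹ b c ≠ regCoef (cov Λ Ω) S b c := by
  have hsne : c ≠ s := fun h => hcS (h ▸ hsS)
  have hanc : ∀ v, v ∈ anc D s → v ∈ anc D c := fun v hv => Relation.ReflTransGen.trans hv hsc
  have hchild : ∀ v, ∃ u, v ∈ anc D c → v ≠ c →
      (v, u) ∈ D ∧ u ∈ anc D c ∧ (v ∈ anc D s → v ≠ s → u ∈ anc D s) := by
    intro v
    by_cases hvs : v ∈ anc D s ∧ v ≠ s
    · obtain ⟨u, hu, hus⟩ := exists_child hvs.1 hvs.2
      exact ⟨u, fun _ _ => ⟨hu, hanc u hus, fun _ _ => hus⟩⟩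
    · by_cases hv : v ∈ anc D c ∧ v ≠ c
      · obtain ⟨u, hu, huc⟩ := exists_child hv.1 hv.2
        exact ⟨u, fun _ _ => ⟨hu, huc, fun h h' => absurd ⟨h, h'⟩ hvs⟩⟩
      · exact ⟨v, fun h h' => absurd ⟨h, h'⟩ hv⟩
  choose nxt hnxt using hchild
  set T₀ : Set (Fin n) := {v | v ∈ anc D c → v = c} with hT₀
  have hmem : ∀ v ∉ T₀, v ∈ anc D c ∧ v ≠ c := fun v hv => by simpa [hT₀] using hv
  have hedge : ∀ v ∉ T₀, (v, nxt v) ∈ D := fun v hv => (hnxt v (hmem v hv).1 (hmem v hv).2).1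
  have hlt₀ : ∀ v ∉ T₀, v < nxt v := fun v hv => hD _ _ (hedge v hv)
  have hlt₁ : ∀ v ∉ T₀ ∪ S, v < nxt v := fun v hv => hlt₀ v fun h => hv (Or.inl h)
  have hcT : c ∈ T₀ := fun _ => rfl
  set Λ := forest T₀ nxt with hΛ
  have hdet : IsUnit (1 - Λ).det := isUnit_det_one_sub_forest hlt₀
  have hpath : (1 - Λ)⁻¹ b c = 1 := by
    rw [hΛ, inv_one_sub_forest_apply hlt₀ hcT, if_pos]
    refine root_mem hlt₀ b (root_of_closed hlt₀ (p := (· ∈ anc D c)) ?_ (hanc b hbs))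
    exact fun v hv _ => (hnxt v (hmem v hv).1 (hmem v hv).2).2.1
  have hroot : root (T₀ ∪ S) nxt hlt₁ b ≠ c := by
    intro h
    have : root (T₀ ∪ S) nxt hlt₁ b ∈ anc D s := by
      refine root_of_closed hlt₁ (p := (· ∈ anc D s)) (fun v hv hvs => ?_) hbs
      have hv₀ := hmem v fun h => hv (Or.inl h)
      exact (hnxt v hv₀.1 hv₀.2).2.2 hvs fun h => hv (Or.inr (h ▸ hsS))
    rw [h] at this
    exact hsne (le_antisymm (le_of_mem_desc hD this) (le_of_mem_desc hD hsc))
  set d : Fin n → ℝ := fun v => if root (T₀ ∪ S) nxt hlt₁ v = c then 1 else 0 with hd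
  have hΩ : BCompatible B (1 : Matrix (Fin n) (Fin n) ℝ) :=
    ⟨Matrix.isSymm_one, Matrix.PosDef.one, fun i j hij _ => Matrix.one_apply_ne hij⟩
  refine ⟨Λ, 1, dSupported_forest hedge, hΩ, ?_⟩
  set y : Fin n → ℝ := ((1 - Λ)⁻¹)ᵀ *ᵥ d with hy
  have hcov : cov Λ 1 *ᵥ ((1 - Λ) *ᵥ d) = y := by
    rw [cov_mulVec, inv_mulVec_eq hdet rfl, Matrix.one_mulVec]
  have hyd : ∀ v, y v = d v + ∑ u, Λ u v * y u := by
    intro v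
    have h : (1 - Λ)ᵀ *ᵥ y = d := by
      rw [hy, Matrix.mulVec_mulVec, ← Matrix.transpose_mul, Matrix.nonsing_inv_mul _ hdet,
        Matrix.transpose_one, Matrix.one_mulVec]
    rw [← h, Matrix.transpose_sub, Matrix.transpose_one, Matrix.sub_mulVec, Matrix.one_mulVec,
      Pi.sub_apply]
    simp [Matrix.mulVec, dotProduct]
  have hy0 : ∀ v, root (T₀ ∪ S) nxt hlt₁ v ≠ c → y v = 0 := by
    intro v
    induction v using WellFoundedLT.induction with
    | ind v ih =>
      intro hv
      rw [hyd, hd]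
      simp only [hv, if_false, zero_add]
      refine Finset.sum_eq_zero fun u _ => ?_
      by_cases hu : u ∉ T₀ ∧ v = nxt u
      · rw [ih u (hu.2 ▸ hlt₀ u hu.1) ?_, mul_zero]
        intro h
        by_cases hm : u ∈ T₀ ∪ S
        · rw [root_of_mem hlt₁ hm] at h
          exact (hmem u hu.1).2 h
        · rw [root_of_notMem hlt₁ hm, ← hu.2] at h
          exact hv h
      · simp [hΛ, forest, hu]
  have hcond : condCov (cov Λ 1) S b c = 0 := by
    rw [condCov_eq_of_residual (posDef_cov hdet hΩ.2.1) hcS (x := (1 - Λ) *ᵥ d), hcov,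
      hy0 b hroot]
    · rw [Matrix.sub_mulVec, Matrix.one_mulVec, Pi.sub_apply, forest_mulVec, if_pos hcT]
      simp [hd, root_of_mem hlt₁ (Or.inl hcT : c ∈ T₀ ∪ S)]
    · intro v hvS hvc
      rw [Matrix.sub_mulVec, Matrix.one_mulVec, Pi.sub_apply, forest_mulVec]
      by_cases hv : v ∈ T₀
      · simp [hd, hv, root_of_mem hlt₁ (Or.inl hv : v ∈ T₀ ∪ S), hvc]
      · have hm : v ∉ T₀ ∪ S := fun h => h.elim hv hvS
        simp [hd, hv, root_of_notMem hlt₁ hm]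
    · intro t ht
      rw [hcov]
      refine hy0 t fun h => hcS ?_
      rw [root_of_mem hlt₁ (Or.inr ht)] at h
      exact h ▸ ht
  rw [regCoef, hcond, zero_div, hpath]
  exact one_ne_zero

/-- If `S` contains no vertex on a directed path from `b` to `c`, then cutting the outgoing edges
of `b` and of `S` leaves a spurious correlation of `b` and `c` given `S`. -/
lemma exists_ne_regCoef_of_forall_notMem (hD : ∀ i j : Fin n, (i, j) ∈ D → i < j)
    (hBsymm : ∀ i j : Fin n, (i, j) ∈ B → (j, i) ∈ B) {S : Set (Fin n)}
    {b c d : Fin n} (hbS : b ∉ S) (hcS : c ∉ S) (hcb : c ≠ b)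
    (hS : ∀ s ∈ S, s ∈ desc D b → s ∉ anc D c)
    (hdb : d ≠ b) (hd : d ∈ desc D b) (hdc : d ∈ anc D c) (hdis : d ∈ disW B (anc D c) b) :
    ∃ Λ Ω : Matrix (Fin n) (Fin n) ℝ, DSupported D Λ ∧ BCompatible B Ω ∧
      (1 - Λ)⁻¹ b c ≠ regCoef (cov Λ Ω) S b c := by
  have hchild : ∀ v, ∃ u, v ∈ anc D c → v ≠ c → (v, u) ∈ D ∧ u ∈ anc D c := by
    intro v
    by_cases hv : v ∈ anc D c ∧ v ≠ c
    · obtain ⟨u, hu⟩ := exists_child hv.1 hv.2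
      exact ⟨u, fun _ _ => hu⟩
    · exact ⟨v, fun h h' => absurd ⟨h, h'⟩ hv⟩
  choose nxt hnxt using hchild
  set T : Set (Fin n) := {v | v ∈ anc D c → v = c ∨ v = b ∨ v ∈ S} with hT
  have hmem : ∀ v ∉ T, v ∈ anc D c ∧ v ≠ c := fun v hv => by
    simp only [hT, Set.mem_ofPred_eq, Classical.not_imp, not_or] at hv
    exact ⟨hv.1, hv.2.1⟩
  have hedge : ∀ v ∉ T, (v, nxt v) ∈ D := fun v hv => (hnxt v (hmem v hv).1 (hmem v hv).2).1
  have hnxtc : ∀ v ∉ T, nxt v ∈ anc D c := fun v hv => (hnxt v (hmem v hv).1 (hmem v hv).2).2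
  have hlt : ∀ v ∉ T, v < nxt v := fun v hv => hD _ _ (hedge v hv)
  have hcT : c ∈ T := fun _ => Or.inl rfl
  have hbT : b ∈ T := fun _ => Or.inr (Or.inl rfl)
  have hST : S ⊆ T := fun s hs _ => Or.inr (Or.inr hs)
  have hrootb : root T nxt hlt b = b := root_of_mem hlt hbT
  have hroot : ∀ v ∈ anc D c, root T nxt hlt v = c ∨ root T nxt hlt v = b ∨
      root T nxt hlt v ∈ S := fun v hv =>
    root_mem hlt v (root_of_closed hlt (p := (· ∈ anc D c)) (fun v hv _ => hnxtc v hv) hv)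
  have hrootd : root T nxt hlt d = c := by
    have hp : root T nxt hlt d ∈ desc D b ∧ root T nxt hlt d ∈ anc D c ∧ b < root T nxt hlt d := by
      refine root_of_closed hlt (p := fun v => v ∈ desc D b ∧ v ∈ anc D c ∧ b < v) ?_
        ⟨hd, hdc, lt_of_le_of_ne (le_of_mem_desc hD hd) hdb.symm⟩
      exact fun v hv h => ⟨Relation.ReflTransGen.tail h.1 (hedge v hv), hnxtc v hv,
        h.2.2.trans (hlt v hv)⟩
    rcases hroot d hdc with h | h | h
    · exact h
    · exact absurd h hp.2.2.ne'
    · exact absurd hp.2.1 (hS _ h hp.1)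
  have hΩ := bCompatible_negNoise hBsymm
  have hdet : IsUnit (1 - forest T nxt).det := isUnit_det_one_sub_forest hlt
  have hC := posDef_cov hdet hΩ.2.1
  refine ⟨forest T nxt, negNoise B, dSupported_forest hedge, hΩ, ?_⟩
  rw [inv_one_sub_forest_apply hlt hcT, hrootb, if_neg hcb.symm]
  intro hzero
  have hcond : condCov (cov (forest T nxt) (negNoise B)) S b c = 0 := by
    rcases div_eq_zero_iff.1 hzero.symm with h | h
    · exact h
    · exact absurd h (condCov_self_pos hC hbS).ne'
  obtain ⟨x, hxc, hx0, hxS, hx⟩ := exists_residual hC hcS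
  have hxT : ∀ v ∉ T, x v = 0 := fun v hv =>
    hx0 v (fun h => hv (hST h)) fun h => hv (h ▸ hcT)
  set z : Fin n → ℝ := fun v => x (root T nxt hlt v) with hz
  have hcov : ∀ w ∈ T, (cov (forest T nxt) (negNoise B) *ᵥ x) w
      = ∑ v with root T nxt hlt v = w, (negNoise B *ᵥ z) v := by
    intro w hw
    rw [cov_mulVec, inv_one_sub_forest_mulVec hlt hxT, Finset.sum_filter]
    simp only [Matrix.mulVec, dotProduct, Matrix.transpose_apply]
    refine Finset.sum_congr rfl fun v _ => ?_
    rw [inv_one_sub_forest_apply hlt hw]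
    split_ifs <;> simp [hz]
  have hz0 : ∀ v, 0 ≤ z v := by
    have : Nonempty (Fin n) := ⟨b⟩
    obtain ⟨v, hv⟩ := Finite.exists_min z
    suffices 0 ≤ z v from fun u => this.trans (hv u)
    by_contra! hneg
    have hvS : root T nxt hlt v ∈ S := by
      by_contra hvS
      by_cases hvc : root T nxt hlt v = c
      · simp only [hz, hvc, hxc] at hneg
        linarith
      · simp [hz, hx0 _ hvS hvc] at hneg
    have hsum := hcov _ (hST hvS)
    rw [hxS _ hvS] at hsum
    refine hsum.not_gt (Finset.sum_neg (fun u hu => ?_) ⟨v, by simp⟩)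
    have huv : z u = z v := congrArg x (Finset.mem_filter.1 hu).2
    exact negNoise_mulVec_neg_of_min (fun w => huv ▸ hv w) (huv ▸ hneg)
  have hprop : ∀ u v, (u, v) ∈ B → u ∈ anc D c → 0 < z v → 0 < z u := by
    intro u v huv hu hv
    by_contra hzu
    have hzu0 : z u = 0 := le_antisymm (not_lt.1 hzu) (hz0 u)
    have hcov0 : (cov (forest T nxt) (negNoise B) *ᵥ x) (root T nxt hlt u) = 0 := by
      rcases hroot u hu with h | h | h
      · simp [hz, h, hxc] at hzu0
      · rw [h, ← hx, hcond]
      · exact hxS _ h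
    rw [hcov _ (root_mem hlt u)] at hcov0
    refine hcov0.not_lt (Finset.sum_neg' (fun w hw => ?_) ⟨u, by simp, ?_⟩)
    · exact negNoise_mulVec_nonpos hz0
        ((congrArg x (Finset.mem_filter.1 hw).2 : z w = z u).trans hzu0)
    · exact negNoise_mulVec_neg_of_adj hz0 hzu0 huv hv
  have hzb : 0 < z b := by
    refine Relation.ReflTransGen.head_induction_on (motive := fun v _ => 0 < z v) hdis ?_ ?_
    · simp [hz, hrootd, hxc]
    · exact fun h _ ih => hprop _ _ h.1 h.2.1 ih
  simp [hz, hrootb, hx0 b hbS hcb.symm] at hzb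

end Graph

/-- if `b` is not fixable in `G_W` for `W = an(c)`, then some directed-path sum
`P b c'` (with `c' ∈ de(b)`, `c' ≠ b`) is not regression identifiable: for every candidate
adjustment set `S ⊆ V \ {b, c'}` there are parameters `Λ, Ω` with `P b c' ≠ β_{bc'·S}`. -/
theorem pathSum_not_regression_identifiable (n : ℕ) (D B : Set (Fin n × Fin n))
    (hD : ∀ i j : Fin n, (i, j) ∈ D → i < j)
    (hBsymm : ∀ i j : Fin n, (i, j) ∈ B → (j, i) ∈ B)
    (hBirr : ∀ i : Fin n, (i, i) ∉ B)
    (b c : Fin n) (hc : c ∈ desc D b) (hcb : c ≠ b)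
    (hnotfix : ∃ c' : Fin n, c' ≠ b ∧ c' ∈ descW D (anc D c) b ∩ disW B (anc D c) b) :
    ∃ c' : Fin n, c' ∈ desc D b ∧ c' ≠ b ∧
      ∀ S : Set (Fin n), S ⊆ ({b, c'} : Set (Fin n))ᶜ →
        ∃ Λ Ω : Matrix (Fin n) (Fin n) ℝ, DSupported D Λ ∧ BCompatible B Ω ∧
          (1 - Λ)⁻¹ b c' ≠ regCoef (cov Λ Ω) S b c' := by
  obtain ⟨d, hdb, hddesc, hddis⟩ := hnotfix
  have hdesc : d ∈ desc D b := Relation.ReflTransGen.mono (fun _ _ h => h.1) b d hddesc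
  have hanc : d ∈ anc D c := by
    rcases Relation.ReflTransGen.cases_tail hddesc with h | ⟨_, _, h⟩
    · exact absurd h hdb
    · exact h.2.2
  refine ⟨c, hc, hcb, fun S hS => ?_⟩
  have hbS : b ∉ S := fun h => hS h (Or.inl rfl)
  have hcS : c ∉ S := fun h => hS h (Or.inr rfl)
  by_cases h : ∃ s ∈ S, s ∈ desc D b ∧ s ∈ anc D c
  · obtain ⟨s, hsS, hsb, hsc⟩ := h
    exact exists_ne_regCoef_of_mem hD hcS hsS hsb hsc
  · push Not at h
    exact exists_ne_regCoef_of_forall_notMem hD hBsymm hbS hcS hcb h hdb hdesc hanc hddis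

end EdgeIntervention
end

section
/- Effect of removing a directed edge on individual data: let M be the V×V matrix with entries M v w = (if v = w then 1 else 0) − λ · (P b v) · (if w = a⋆ then 1 else 0), i.e., the linear map sending X to X⋆ with X⋆ v = X v − λ · (P b v) · X a⋆. Then M * Σ * Mᵀ = Σ⋆. (Hence if X ∼ N(0, Σ) then X⋆ = M X ∼ N(0, Σ⋆).) -/
open Matrix

attribute [local instance] Classical.propDecidable

namespace EdgeIntervention

variable {n : ℕ}

/-- If `Λ` is supported on edges that increase, then `1 - Λ` is upper triangular. -/
theorem DSupported.blockTriangular_one_sub {D : Set (Fin n × Fin n)}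
    (hD : ∀ i j : Fin n, (i, j) ∈ D → i < j) {Λ : Matrix (Fin n) (Fin n) ℝ}
    (hΛ : DSupported D Λ) : (1 - Λ).BlockTriangular id :=
  blockTriangular_one.sub fun i j hij => hΛ i j fun h => (hD i j h).asymm hij

/-- If `Λ` is supported on edges that increase, then `1 - Λ` has determinant one. -/
theorem DSupported.det_one_sub {D : Set (Fin n × Fin n)}
    (hD : ∀ i j : Fin n, (i, j) ∈ D → i < j) {Λ : Matrix (Fin n) (Fin n) ℝ}
    (hΛ : DSupported D Λ) : (1 - Λ).det = 1 := by
  rw [det_of_isUpperTriangular (hΛ.blockTriangular_one_sub hD)]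
  refine Finset.prod_eq_one fun i _ => ?_
  simp [hΛ i i fun h => (hD i i h).false]

/-- If `Λ` is supported on edges that increase, then `(1 - Λ)⁻¹` is upper triangular. -/
theorem DSupported.inv_one_sub_apply_of_lt {D : Set (Fin n × Fin n)}
    (hD : ∀ i j : Fin n, (i, j) ∈ D → i < j) {Λ : Matrix (Fin n) (Fin n) ℝ}
    (hΛ : DSupported D Λ) {i j : Fin n} (hij : j < i) : (1 - Λ)⁻¹ i j = 0 := by
  have : Invertible (1 - Λ) := invertibleOfIsUnitDet _ (by simp [hΛ.det_one_sub hD])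
  exact blockTriangular_inv_of_blockTriangular (hΛ.blockTriangular_one_sub hD) hij

theorem removeEdge_eq_sub_single (Λ : Matrix (Fin n) (Fin n) ℝ) (a b : Fin n) :
    removeEdge Λ a b = Λ - single a b (Λ a b) := by
  ext i j
  by_cases h : i = a ∧ j = b
  · obtain ⟨rfl, rfl⟩ := h
    simp [removeEdge]
  · have h' : ¬(a = i ∧ b = j) := fun h' => h ⟨h'.1.symm, h'.2.symm⟩
    simp [removeEdge, h, h']

/-- A rank-one update of an invertible matrix along an entry where the inverse vanishes. -/
theorem inv_add_single {A : Matrix (Fin n) (Fin n) ℝ} (hA : IsUnit A.det) {a b : Fin n}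
    (c : ℝ) (hba : A⁻¹ b a = 0) :
    (A + single a b c)⁻¹ = A⁻¹ * (1 - single a b c * A⁻¹) := by
  refine inv_eq_right_inv ?_
  have h : single a b c * A⁻¹ * single a b c = 0 := by
    rw [single_mul_mul_single, hba]
    simp
  calc (A + single a b c) * (A⁻¹ * (1 - single a b c * A⁻¹))
      = (A * A⁻¹ + single a b c * A⁻¹) * (1 - single a b c * A⁻¹) := by noncomm_ring
    _ = 1 - single a b c * A⁻¹ * single a b c * A⁻¹ := by
        rw [mul_nonsing_inv A hA]
        noncomm_ring
    _ = 1 := by rw [h]; simp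

/-- effect of removing the directed edge `a⋆ → b` on individual data: the
linear map `X ↦ X⋆` with `X⋆ v = X v − λ (P b v) X a⋆` transforms `Σ` into `Σ⋆`, i.e.
`M * Σ * Mᵀ = Σ⋆` for the corresponding matrix `M`. -/
theorem remove_edge_data (n : ℕ) (D B : Set (Fin n × Fin n))
    (hD : ∀ i j : Fin n, (i, j) ∈ D → i < j)
    (hBsymm : ∀ i j : Fin n, (i, j) ∈ B → (j, i) ∈ B)
    (hBirr : ∀ i : Fin n, (i, i) ∉ B)
    (Λ Ω : Matrix (Fin n) (Fin n) ℝ)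
    (hΛ : DSupported D Λ) (hΩ : BCompatible B Ω)
    (astar b : Fin n) (hab : (astar, b) ∈ D)
    (M : Matrix (Fin n) (Fin n) ℝ)
    (hM : M = Matrix.of fun v w : Fin n =>
      (if v = w then (1 : ℝ) else 0)
        - Λ astar b * (1 - Λ)⁻¹ b v * (if w = astar then 1 else 0)) :
    M * cov Λ Ω * Mᵀ = cov (removeEdge Λ astar b) Ω := by
  have hMt : Mᵀ = 1 - single astar b (Λ astar b) * (1 - Λ)⁻¹ := by
    ext w v
    by_cases hw : w = astar
    · subst hw
      simp [hM, one_apply, eq_comm]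
    · simp [hM, one_apply, hw, Ne.symm hw, eq_comm]
  have hinv : (1 - removeEdge Λ astar b)⁻¹ = (1 - Λ)⁻¹ * Mᵀ := by
    rw [hMt, ← inv_add_single (by simp [hΛ.det_one_sub hD]) _
      (hΛ.inv_one_sub_apply_of_lt hD (hD _ _ hab)), removeEdge_eq_sub_single, sub_sub_eq_add_sub,
      add_sub_right_comm]
  simp only [cov, hinv, transpose_mul, transpose_transpose, Matrix.mul_assoc]

end EdgeIntervention
end

section
/- Cut-vertex factorization of directed path sums: let Λ be D-supported, b, c, u ∈ V, and suppose that every directed path from b to c contains u as one of its vertices. Then ((1 − Λ)⁻¹) b c = ((1 − Λ)⁻¹) b u · ((1 − Λ)⁻¹) u c. More generally, if u₁, …, u_k ∈ V are such that every directed path from b to c passes through u₁, …, u_k in this order, then ((1 − Λ)⁻¹) b c = ((1 − Λ)⁻¹) b u₁ · ((1 − Λ)⁻¹) u₁ u₂ · ⋯ · ((1 − Λ)⁻¹) u_k c. -/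
open Matrix

attribute [local instance] Classical.propDecidable

namespace EdgeIntervention

variable {n : ℕ}

/-- `l` lists the vertices of a directed path from `b` to `c`. -/
structure IsDirectedPath (D : Set (Fin n × Fin n)) (b c : Fin n) (l : List (Fin n)) : Prop where
  isChain : l.IsChain fun i j => (i, j) ∈ D
  head : l.head? = some b
  last : l.getLast? = some c

namespace IsDirectedPath

variable {D : Set (Fin n × Fin n)} {b c u : Fin n} {l m : List (Fin n)}

theorem singleton (b : Fin n) : IsDirectedPath D b b [b] :=
  ⟨by simp, by simp, by simp⟩

theorem concat (h : IsDirectedPath D b c l) (hcu : (c, u) ∈ D) :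
    IsDirectedPath D b u (l ++ [u]) := by
  refine ⟨List.isChain_append.2 ⟨h.isChain, by simp, ?_⟩, ?_, by simp⟩
  · intro x hx y hy
    rw [h.last] at hx
    simp at hx hy
    subst hx hy
    exact hcu
  · simp [List.head?_append, h.head]

theorem trans (h : IsDirectedPath D b u (l ++ [u])) (h' : IsDirectedPath D u c (u :: m)) :
    IsDirectedPath D b c (l ++ u :: m) := by
  refine ⟨List.isChain_append.2 ⟨(List.isChain_append.1 h.isChain).1, h'.isChain, ?_⟩, ?_, ?_⟩
  · simpa using (List.isChain_append.1 h.isChain).2.2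
  · simpa [List.head?_append] using h.head
  · rw [List.getLast?_append, h'.last]; rfl

theorem pairwise_lt (hD : ∀ i j, (i, j) ∈ D → i < j) (h : IsDirectedPath D b c l) :
    l.Pairwise (· < ·) :=
  List.isChain_iff_pairwise.1 (h.isChain.imp hD)

theorem le (hD : ∀ i j, (i, j) ∈ D → i < j) (h : IsDirectedPath D b c l) : b ≤ c := by
  obtain ⟨m, rfl⟩ := List.head?_eq_some_iff.1 h.head
  have hp := List.pairwise_cons.1 (h.pairwise_lt hD)
  rcases List.mem_cons.1 (List.mem_of_getLast? h.last) with hc | hc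
  · exact hc.ge
  · exact (hp.1 c hc).le

/-- A property of directed paths encoded as functions transfers to their vertex lists. -/
theorem sublist_of_forall_fun {L : List (Fin n)}
    (H : ∀ (k : ℕ) (f : Fin (k + 1) → Fin n),
      f 0 = b → f (Fin.last k) = c → (∀ t : Fin k, (f t.castSucc, f t.succ) ∈ D) →
      ∃ g : Fin L.length → Fin (k + 1), StrictMono g ∧ ∀ i : Fin L.length, f (g i) = L.get i)
    (h : IsDirectedPath D b c l) : L.Sublist l := by
  obtain ⟨m, rfl⟩ := List.head?_eq_some_iff.1 h.head
  obtain ⟨g, hg, hgL⟩ := H m.length (b :: m).get rfl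
    (by simpa [List.getLast?_eq_getElem?] using h.last)
    (fun t => List.isChain_iff_getElem.1 h.isChain t (by simp))
  exact List.sublist_iff_exists_fin_orderEmbedding_get_eq.2
    ⟨OrderEmbedding.ofStrictMono g hg, fun i => (hgL i).symm⟩

end IsDirectedPath

section PathSums

variable {D : Set (Fin n × Fin n)} {Λ : Matrix (Fin n) (Fin n) ℝ}

theorem isUnit_one_sub_of_dSupported (hD : ∀ i j, (i, j) ∈ D → i < j) (hΛ : DSupported D Λ) :
    IsUnit (1 - Λ).det := by
  have hzero : ∀ i j, j ≤ i → Λ i j = 0 := fun i j hij =>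
    hΛ i j fun h => hij.not_gt (hD i j h)
  have htri : (1 - Λ).IsUpperTriangular := fun i j (hij : j < i) => by
    simp [hzero i j hij.le, Matrix.one_apply_ne hij.ne']
  rw [Matrix.det_of_isUpperTriangular htri]
  simp [hzero]

theorem inv_one_sub_apply (hD : ∀ i j, (i, j) ∈ D → i < j) (hΛ : DSupported D Λ) (b c : Fin n) :
    (1 - Λ)⁻¹ b c = (1 : Matrix (Fin n) (Fin n) ℝ) b c + ∑ k, (1 - Λ)⁻¹ b k * Λ k c := by
  have h := Matrix.nonsing_inv_mul _ (isUnit_one_sub_of_dSupported hD hΛ)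
  rw [mul_sub, mul_one, sub_eq_iff_eq_add] at h
  simpa [Matrix.mul_apply] using congrFun (congrFun h b) c

theorem exists_isDirectedPath_of_inv_ne_zero (hD : ∀ i j, (i, j) ∈ D → i < j)
    (hΛ : DSupported D Λ) (b c : Fin n) (h : (1 - Λ)⁻¹ b c ≠ 0) :
    ∃ l, IsDirectedPath D b c l := by
  induction c using WellFoundedLT.induction with
  | ind c ih =>
    by_cases hbc : b = c
    · exact hbc ▸ ⟨_, .singleton b⟩
    · rw [inv_one_sub_apply hD hΛ, Matrix.one_apply_ne hbc, zero_add] at h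
      obtain ⟨k, -, hk⟩ := Finset.exists_ne_zero_of_sum_ne_zero h
      have hkc : (k, c) ∈ D := by_contra fun hn => hk (by rw [hΛ k c hn, mul_zero])
      obtain ⟨l, hl⟩ := ih k (hD k c hkc) (left_ne_zero_of_mul hk)
      exact ⟨_, hl.concat hkc⟩

theorem inv_one_sub_apply_self (hD : ∀ i j, (i, j) ∈ D → i < j) (hΛ : DSupported D Λ)
    (b : Fin n) : (1 - Λ)⁻¹ b b = 1 := by
  rw [inv_one_sub_apply hD hΛ, Matrix.one_apply_eq, add_eq_left]
  refine Finset.sum_eq_zero fun k _ => by_contra fun hk => ?_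
  have hkb : (k, b) ∈ D := by_contra fun hn => hk (by rw [hΛ k b hn, mul_zero])
  obtain ⟨l, hl⟩ := exists_isDirectedPath_of_inv_ne_zero hD hΛ b k (left_ne_zero_of_mul hk)
  exact (hl.le hD).not_gt (hD k b hkb)

theorem inv_one_sub_apply_eq_mul (hD : ∀ i j, (i, j) ∈ D → i < j) (hΛ : DSupported D Λ)
    {b c u : Fin n} (H : ∀ l, IsDirectedPath D b c l → u ∈ l) :
    (1 - Λ)⁻¹ b c = (1 - Λ)⁻¹ b u * (1 - Λ)⁻¹ u c := by
  induction c using WellFoundedLT.induction with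
  | ind c ih =>
    by_cases huc : u = c
    · rw [huc, inv_one_sub_apply_self hD hΛ c, mul_one]
    · have hbc : b ≠ c := by
        rintro rfl
        exact huc (by simpa using H _ (.singleton b))
      rw [inv_one_sub_apply hD hΛ b c, inv_one_sub_apply hD hΛ u c, Matrix.one_apply_ne hbc,
        Matrix.one_apply_ne huc, zero_add, zero_add, Finset.mul_sum]
      refine Finset.sum_congr rfl fun k _ => ?_
      by_cases hkc : (k, c) ∈ D
      · rw [ih k (hD k c hkc) fun l hl => by simpa [huc] using H _ (hl.concat hkc), mul_assoc]
      · simp [hΛ k c hkc]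

theorem inv_one_sub_apply_eq_prod (hD : ∀ i j, (i, j) ∈ D → i < j) (hΛ : DSupported D Λ)
    {b c : Fin n} {L : List (Fin n)} (H : ∀ l, IsDirectedPath D b c l → L.Sublist l) :
    (1 - Λ)⁻¹ b c = (((b :: L).zip (L ++ [c])).map fun q => (1 - Λ)⁻¹ q.1 q.2).prod := by
  induction L generalizing b with
  | nil => simp
  | cons u L ih =>
    rw [inv_one_sub_apply_eq_mul hD hΛ fun l hl => (H l hl).subset List.mem_cons_self]
    simp only [List.cons_append, List.zip_cons_cons, List.map_cons, List.prod_cons]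
    by_cases hbu : (1 - Λ)⁻¹ b u = 0
    · simp [hbu]
    congr 1
    obtain ⟨p, hp⟩ := exists_isDirectedPath_of_inv_ne_zero hD hΛ b u hbu
    obtain ⟨p, rfl⟩ := List.getLast?_eq_some_iff.1 hp.last
    refine ih fun q hq => ?_
    obtain ⟨q, rfl⟩ := List.head?_eq_some_iff.1 hq.head
    have hu : u ∉ p := fun hup =>
      lt_irrefl u ((List.pairwise_append.1 (hp.pairwise_lt hD)).2.2 u hup u (by simp))
    obtain ⟨s, t, hst, hs, ht⟩ := List.sublist_append_iff.1 (H _ (hp.trans hq))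
    cases s with
    | nil =>
      rw [List.nil_append] at hst
      exact (List.sublist_cons_self u L).trans (hst ▸ ht)
    | cons a s =>
      rw [List.cons_append, List.cons.injEq] at hst
      exact absurd (hs.subset (by simp [hst.1])) hu

end PathSums

/-- cut-vertex factorization of directed path sums.  If every directed path
from `b` to `c` contains `u`, then `P b c = P b u * P u c`; more generally, if every directed
path from `b` to `c` passes through the vertices of `L` in order, then `P b c` factors as the
product of consecutive path sums along `b :: L ++ [c]`. -/
theorem cut_vertex_factorization (n : ℕ) (D : Set (Fin n × Fin n))
    (hD : ∀ i j : Fin n, (i, j) ∈ D → i < j)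
    (Λ : Matrix (Fin n) (Fin n) ℝ) (hΛ : DSupported D Λ) :
    (∀ b c u : Fin n,
      (∀ (k : ℕ) (f : Fin (k + 1) → Fin n),
          f 0 = b → f (Fin.last k) = c → (∀ t : Fin k, (f t.castSucc, f t.succ) ∈ D) →
          ∃ t : Fin (k + 1), f t = u) →
      (1 - Λ)⁻¹ b c = (1 - Λ)⁻¹ b u * (1 - Λ)⁻¹ u c) ∧
    (∀ (b c : Fin n) (L : List (Fin n)),
      (∀ (k : ℕ) (f : Fin (k + 1) → Fin n),
          f 0 = b → f (Fin.last k) = c → (∀ t : Fin k, (f t.castSucc, f t.succ) ∈ D) →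
          ∃ g : Fin L.length → Fin (k + 1), StrictMono g ∧ ∀ i : Fin L.length, f (g i) = L.get i) →
      (1 - Λ)⁻¹ b c
        = (((b :: L).zip (L ++ [c])).map fun q => (1 - Λ)⁻¹ q.1 q.2).prod) := by
  refine ⟨fun b c u H => inv_one_sub_apply_eq_mul hD hΛ fun l hl => ?_,
    fun b c L H => inv_one_sub_apply_eq_prod hD hΛ fun l hl => hl.sublist_of_forall_fun H⟩
  refine List.singleton_sublist.1 (hl.sublist_of_forall_fun fun k f h0 hk hf => ?_)
  obtain ⟨t, ht⟩ := H k f h0 hk hf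
  have : Subsingleton (Fin [u].length) := inferInstanceAs (Subsingleton (Fin 1))
  exact ⟨fun _ => t, Subsingleton.strictMono _, fun i => by simpa using ht⟩

end EdgeIntervention
end
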